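/- For every integer r ≥ 1 and every nonnegative integer m, the number of lattice points in the m-th dilation of the Reeve tetrahedron R_r equals (r/6)m³ + m² + (2 − r/6)m + 1. -/

import Mathlib

/-- The real point of `ℝ³` corresponding to an integer vector. -/
def Z3R (v : Fin 3 → ℤ) : Fin 3 → ℝ := fun i => (v i : ℝ)

/-- The set of lattice points of `ℝ³`. -/
def latticePts : Set (Fin 3 → ℝ) := Set.range Z3R

/-- The Reeve tetrahedron `R_r = conv((0,0,0), (1,0,0), (0,1,0), (1,1,r)) ⊆ ℝ³`. -/
def reeve (r : ℤ) : Set (Fin 3 → ℝ) :=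
  convexHull ℝ ({Z3R ![0, 0, 0], Z3R ![1, 0, 0], Z3R ![0, 1, 0], Z3R ![1, 1, r]} :
    Set (Fin 3 → ℝ))

/-- The Reeve tetrahedron is cut out by its four facet inequalities. -/
theorem mem_reeve_iff {r : ℤ} (hr : 1 ≤ r) (v : Fin 3 → ℝ) :
    v ∈ reeve r ↔ 0 ≤ v 2 ∧ v 2 ≤ r * v 0 ∧ v 2 ≤ r * v 1 ∧ r * (v 0 + v 1 - 1) ≤ v 2 := by
  have hr0 : (0 : ℝ) < r := by exact_mod_cast (by lia : 0 < r)
  constructor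
  · intro hv
    have hconv : Convex ℝ {v : Fin 3 → ℝ | 0 ≤ v 2 ∧ v 2 ≤ r * v 0 ∧ v 2 ≤ r * v 1 ∧
        r * (v 0 + v 1 - 1) ≤ v 2} := by
      rintro x ⟨hx1, hx2, hx3, hx4⟩ y ⟨hy1, hy2, hy3, hy4⟩ a b ha hb hab
      obtain rfl : b = 1 - a := by linarith
      simp only [Set.mem_ofPred_eq, Pi.add_apply, Pi.smul_apply, smul_eq_mul]
      refine ⟨by positivity, ?_, ?_, ?_⟩
      · linarith [mul_le_mul_of_nonneg_left hx2 ha, mul_le_mul_of_nonneg_left hy2 hb]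
      · linarith [mul_le_mul_of_nonneg_left hx3 ha, mul_le_mul_of_nonneg_left hy3 hb]
      · linarith [mul_le_mul_of_nonneg_left hx4 ha, mul_le_mul_of_nonneg_left hy4 hb]
    refine convexHull_min ?_ hconv hv
    rintro x (rfl | rfl | rfl | rfl) <;> simp [Z3R, hr0.le]
  · rintro ⟨h1, h2, h3, h4⟩
    have hmem : ∀ i : Fin 4, ![Z3R ![0, 0, 0], Z3R ![1, 0, 0], Z3R ![0, 1, 0], Z3R ![1, 1, r]] i ∈
        reeve r := by
      intro i
      apply subset_convexHull ℝ
      fin_cases i <;> simp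
    set d := v 2 / r with hd
    have hd2 : v 2 = r * d := by rw [hd]; field_simp
    rw [hd2] at h1 h2 h3 h4
    have hd0 : 0 ≤ d := nonneg_of_mul_nonneg_right h1 hr0
    have hd1 := le_of_mul_le_mul_left h2 hr0
    have hd3 := le_of_mul_le_mul_left h3 hr0
    have hd4 := le_of_mul_le_mul_left h4 hr0
    have hconv : Convex ℝ (reeve r) := convex_convexHull ℝ _
    have key := hconv.sum_mem (t := Finset.univ)
      (w := ![1 - v 0 - v 1 + d, v 0 - d, v 1 - d, d])
      (by intro i _; fin_cases i <;> simp <;> linarith)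
      (by simp [Fin.sum_univ_four]; ring) (fun i _ => hmem i)
    convert key using 1
    funext i
    fin_cases i <;> simp [Fin.sum_univ_four, Z3R, hd2, mul_comm]

/-- The dilations of the Reeve tetrahedron are cut out by the dilated facet inequalities. -/
theorem mem_smul_reeve_iff {r : ℤ} (hr : 1 ≤ r) (m : ℕ) (v : Fin 3 → ℝ) :
    v ∈ (fun x => (m : ℝ) • x) '' reeve r ↔
      0 ≤ v 2 ∧ v 2 ≤ r * v 0 ∧ v 2 ≤ r * v 1 ∧ r * (v 0 + v 1 - m) ≤ v 2 := by
  have hr0 : (0 : ℝ) < r := by exact_mod_cast (by lia : 0 < r)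
  constructor
  · rintro ⟨w, hw, rfl⟩
    obtain ⟨h1, h2, h3, h4⟩ := (mem_reeve_iff hr w).1 hw
    have hm : (0 : ℝ) ≤ m := m.cast_nonneg
    simp only [Pi.smul_apply, smul_eq_mul]
    refine ⟨by positivity, ?_, ?_, ?_⟩
    · linarith [mul_le_mul_of_nonneg_left h2 hm]
    · linarith [mul_le_mul_of_nonneg_left h3 hm]
    · linarith [mul_le_mul_of_nonneg_left h4 hm]
  · rintro ⟨h1, h2, h3, h4⟩
    rcases m.eq_zero_or_pos with rfl | hm
    · have h0 : v 0 = 0 := by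
        apply le_antisymm <;> refine le_of_mul_le_mul_left ?_ hr0 <;> simp at h4 ⊢ <;> linarith
      have h5 : v 1 = 0 := by
        apply le_antisymm <;> refine le_of_mul_le_mul_left ?_ hr0 <;> simp at h4 ⊢ <;> linarith
      have h6 : v 2 = 0 := by rw [h0] at h2; linarith
      refine ⟨0, (mem_reeve_iff hr 0).2 (by simp [hr0.le]), ?_⟩
      ext i
      fin_cases i <;> simp [h0, h5, h6]
    · have hm0 : (0 : ℝ) < m := by exact_mod_cast hm
      refine ⟨(m : ℝ)⁻¹ • v, (mem_reeve_iff hr _).2 ?_, smul_inv_smul₀ hm0.ne' v⟩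
      have hi : (0 : ℝ) ≤ (m : ℝ)⁻¹ := by positivity
      have hmi : (m : ℝ)⁻¹ * m = 1 := inv_mul_cancel₀ hm0.ne'
      simp only [Pi.smul_apply, smul_eq_mul]
      refine ⟨by positivity, ?_, ?_, ?_⟩
      · linarith [mul_le_mul_of_nonneg_left h2 hi]
      · linarith [mul_le_mul_of_nonneg_left h3 hi]
      · have := mul_le_mul_of_nonneg_left h4 hi
        linear_combination this + (r : ℝ) * hmi

/-- The distance from `(x, y)` to the boundary of the square `[0, m]²`. -/
def squareDepth (m x y : ℕ) : ℤ := min (min x y) (min (m - x) (m - y))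

theorem sum_squareDepth (m : ℕ) :
    6 * ∑ x ∈ Finset.range (m + 1), ∑ y ∈ Finset.range (m + 1), squareDepth m x y =
      (m : ℤ) ^ 3 - m := by
  induction m using Nat.twoStepInduction with
  | zero => simp [squareDepth]
  | one => simp [squareDepth, Finset.sum_range_succ]
  | more m ih _ =>
    have hstep : ∀ x y, squareDepth (m + 2) (x + 1) (y + 1) = 1 + squareDepth m x y := by
      intro x y
      simp only [squareDepth]
      lia
    have hx0 : ∀ y ∈ Finset.range (m + 2 + 1), squareDepth (m + 2) 0 y = 0 := by
      intro y hy
      simp only [squareDepth, Finset.mem_range] at *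
      lia
    have hx1 : ∀ y ∈ Finset.range (m + 2 + 1), squareDepth (m + 2) (m + 2) y = 0 := by
      intro y hy
      simp only [squareDepth, Finset.mem_range] at *
      lia
    have hy : ∀ x ∈ Finset.range (m + 1),
        ∑ y ∈ Finset.range (m + 2 + 1), squareDepth (m + 2) (x + 1) y =
          (m + 1) + ∑ y ∈ Finset.range (m + 1), squareDepth m x y := by
      intro x hx
      have h0 : squareDepth (m + 2) (x + 1) 0 = 0 := by
        simp only [squareDepth, Finset.mem_range] at *
        lia
      have h1 : squareDepth (m + 2) (x + 1) (m + 1 + 1) = 0 := by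
        simp only [squareDepth, Finset.mem_range] at *
        lia
      rw [Finset.sum_range_succ', Finset.sum_range_succ, h0, h1]
      simp [hstep, Finset.sum_add_distrib]
    rw [Finset.sum_range_succ, Finset.sum_eq_zero hx1, Finset.sum_range_succ',
      Finset.sum_eq_zero hx0, Finset.sum_congr rfl hy, Finset.sum_add_distrib]
    simp only [Finset.sum_const, Finset.card_range, nsmul_eq_mul]
    push_cast
    linear_combination ih

/-- The lattice points of the `m`-th dilation of `R_r`, as pairs `(x, y)` together with a
height `z`. -/
noncomputable def reevePoints (r : ℤ) (m : ℕ) : Finset ((_ : ℕ × ℕ) × ℤ) :=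
  (Finset.range (m + 1) ×ˢ Finset.range (m + 1)).sigma fun p =>
    Finset.Icc (r * max 0 ((p.1 : ℤ) + p.2 - m)) (r * min (p.1 : ℤ) p.2)

theorem card_reevePoints {r : ℤ} (hr : 1 ≤ r) (m : ℕ) :
    ((reevePoints r m).card : ℤ) = (m + 1) ^ 2 +
      r * ∑ x ∈ Finset.range (m + 1), ∑ y ∈ Finset.range (m + 1), squareDepth m x y := by
  have hcard : ∀ x ∈ Finset.range (m + 1), ∀ y ∈ Finset.range (m + 1),
      ((Finset.Icc (r * max 0 ((x : ℤ) + y - m)) (r * min (x : ℤ) y)).card : ℤ) =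
        1 + r * squareDepth m x y := by
    intro x hx y hy
    have h : min (x : ℤ) y = max 0 ((x : ℤ) + y - m) + squareDepth m x y := by
      simp only [squareDepth]
      lia
    have h0 : 0 ≤ squareDepth m x y := by
      simp only [squareDepth, Finset.mem_range] at *
      lia
    have h1 : 0 ≤ r * squareDepth m x y := mul_nonneg (by lia) h0
    rw [Int.card_Icc, h, Int.toNat_of_nonneg] <;> linarith
  rw [reevePoints, Finset.card_sigma, Finset.sum_product]
  push_cast
  rw [Finset.sum_congr rfl fun x hx => Finset.sum_congr rfl (hcard x hx)]
  simp only [Finset.sum_add_distrib, ← Finset.mul_sum, Finset.sum_const, Finset.card_range,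
    nsmul_eq_mul]
  push_cast
  ring

theorem smul_reeve_inter_latticePts {r : ℤ} (hr : 1 ≤ r) (m : ℕ) :
    (fun x => (m : ℝ) • x) '' reeve r ∩ latticePts =
      (fun q : (_ : ℕ × ℕ) × ℤ => Z3R ![q.1.1, q.1.2, q.2]) '' reevePoints r m := by
  have hr0 : 0 < r := by lia
  ext v
  constructor
  · rintro ⟨hv, w, rfl⟩
    obtain ⟨h1, h2, h3, h4⟩ := (mem_smul_reeve_iff hr m _).1 hv
    simp only [Z3R] at h1 h2 h3 h4
    norm_cast at h1 h2 h3 h4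
    have hx : 0 ≤ w 0 := nonneg_of_mul_nonneg_right (h1.trans h2) hr0
    have hy : 0 ≤ w 1 := nonneg_of_mul_nonneg_right (h1.trans h3) hr0
    have hym := le_of_mul_le_mul_left (h4.trans h2) hr0
    have hxm := le_of_mul_le_mul_left (h4.trans h3) hr0
    refine ⟨⟨⟨(w 0).toNat, (w 1).toNat⟩, w 2⟩, ?_, ?_⟩
    · simp only [reevePoints, Finset.mem_coe, Finset.mem_sigma, Finset.mem_product,
        Finset.mem_range, Finset.mem_Icc, Int.toNat_of_nonneg hx, Int.toNat_of_nonneg hy,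
        mul_max_of_nonneg _ _ hr0.le, mul_min_of_nonneg _ _ hr0.le, max_le_iff, le_min_iff,
        mul_zero]
      exact ⟨⟨by lia, by lia⟩, ⟨h1, h4⟩, h2, h3⟩
    · funext i
      fin_cases i <;> simp [Z3R, hx, hy]
  · rintro ⟨⟨⟨x, y⟩, z⟩, hq, rfl⟩
    simp only [reevePoints, Finset.mem_coe, Finset.mem_sigma, Finset.mem_Icc,
      mul_max_of_nonneg _ _ hr0.le, mul_min_of_nonneg _ _ hr0.le, max_le_iff, le_min_iff,
      mul_zero] at hq
    obtain ⟨-, ⟨h1, h4⟩, h2, h3⟩ := hq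
    refine ⟨(mem_smul_reeve_iff hr m _).2 ?_, _, rfl⟩
    simp only [Z3R, Matrix.cons_val]
    rify at h1 h2 h3 h4
    exact ⟨h1, h2, h3, h4⟩

theorem Z3R_injective : Function.Injective Z3R := fun v w h => by
  ext i
  exact Int.cast_injective (congrFun h i)

theorem ncard_smul_reeve_inter_latticePts {r : ℤ} (hr : 1 ≤ r) (m : ℕ) :
    ((fun x => (m : ℝ) • x) '' reeve r ∩ latticePts).ncard = (reevePoints r m).card := by
  rw [smul_reeve_inter_latticePts hr, Set.ncard_image_of_injective, Set.ncard_coe_finset]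
  rintro ⟨⟨x, y⟩, z⟩ ⟨⟨x', y'⟩, z'⟩ h
  have h' := Z3R_injective h
  have h0 := congrFun h' 0
  have h1 := congrFun h' 1
  have h2 := congrFun h' 2
  simp at h0 h1 h2
  simp [h0, h1, h2]

/-- For every integer `r ≥ 1` and every nonnegative integer `m`, the number of lattice
points in the `m`-th dilation of the Reeve tetrahedron `R_r` equals
`(r/6) m³ + m² + (2 - r/6) m + 1`. -/
theorem reeve_ehrhart (r : ℤ) (hr : 1 ≤ r) (m : ℕ) :
    ((((fun x => (m : ℝ) • x) '' reeve r ∩ latticePts).ncard : ℝ)) =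
      (r : ℝ) / 6 * m ^ 3 + m ^ 2 + (2 - (r : ℝ) / 6) * m + 1 := by
  have hcard := card_reevePoints hr m
  have hsum := sum_squareDepth m
  rw [ncard_smul_reeve_inter_latticePts hr]
  rify at hcard hsum
  linear_combination hcard + (r : ℝ) / 6 * hsum
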